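/- Let u be a column-standard λ-tableau. Then over the integers, e_u = e_{ū} + x, where ū is the row-straightening of u and x is an integral linear combination of standard polytabloids e_v with ū strictly dominating v in the dominance order on row-standard tableaux. -/

import Mathlib

open scoped Classical

/-- A tableau is encoded by its row function `r` and column function `c`:
entry `m` (standing for `m+1`) sits in row `r m`, column `c m`.  Its tabloid
is `r`, and tableau `t·g` has tabloid `r ∘ g⁻¹`.  The integral polytabloid is
`e_t = ∑_{g ∈ C(t)} sgn(g) · {t·g}` with `C(t)` the column stabiliser. -/
noncomputable def polytabloid {n : ℕ} (r c : Fin n → ℕ) : (Fin n → ℕ) →₀ ℤ :=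
  ∑ g ∈ Finset.univ.filter (fun g : Equiv.Perm (Fin n) => c ∘ ⇑g = c),
    ((Equiv.Perm.sign g : ℤ)) • Finsupp.single (r ∘ ⇑g⁻¹) (1 : ℤ)

/-- `(r, c)` is a `lam`-tableau, `lam` having `k` rows. -/
def IsTabOf {n : ℕ} (lam : ℕ → ℕ) (k : ℕ) (r c : Fin n → ℕ) : Prop :=
  (∀ m : Fin n, r m < k ∧ c m < lam (r m)) ∧
    Function.Injective (fun m : Fin n => (r m, c m))

/-- Rows increase from left to right. -/
def RowStd {n : ℕ} (r c : Fin n → ℕ) : Prop :=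
  ∀ m m' : Fin n, r m = r m' → c m < c m' → m < m'

/-- Columns increase from top to bottom. -/
def ColStd {n : ℕ} (r c : Fin n → ℕ) : Prop :=
  ∀ m m' : Fin n, c m = c m' → r m < r m' → m < m'

/-- The number of entries `≤ i` (i.e. with index `< i`) lying in the first
`R` rows; these are the partial sums of the composition `sh(t^{≤ i})`. -/
def shCount {n : ℕ} (r : Fin n → ℕ) (i R : ℕ) : ℕ :=
  (Finset.univ.filter (fun m : Fin n => (m : ℕ) < i ∧ r m < R)).card

/-- Dominance order on row-standard tableaux (via row functions):
`s ⊵ t` iff `sh(s^{≤i}) ⊵ sh(t^{≤i})` for all `i`. -/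
def TabDominates {n : ℕ} (rs rt : Fin n → ℕ) : Prop :=
  ∀ i R, shCount rt i R ≤ shCount rs i R

/-- The column function of the row-standard tableau with row function `r`. -/
def rowSortCol {n : ℕ} (r : Fin n → ℕ) : Fin n → ℕ := fun m =>
  (Finset.univ.filter (fun m' : Fin n => r m' = r m ∧ m' < m)).card

/-- The row functions that agree with `ρ₀` off `X` and take values in `{i, j}` on `X`. -/
def rowBox {n : ℕ} (i j : ℕ) (X : Finset (Fin n)) (ρ₀ : Fin n → ℕ) : Set (Fin n → ℕ) :=
  {ρ | (∀ m, m ∉ X → ρ m = ρ₀ m) ∧ ∀ m ∈ X, ρ m = i ∨ ρ m = j}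

/-- The combinations of rearrangements of `r` whose coefficients sum to zero over every `rowBox`
on more than `lam i` entries.  It contains all `lam`-polytabloids. -/
noncomputable def boxKernel {n : ℕ} (lam : ℕ → ℕ) (r : Fin n → ℕ) :
    Submodule ℤ ((Fin n → ℕ) →₀ ℤ) where
  carrier := {y | (∀ i j X ρ₀, i ≤ j → lam i < X.card →
      Finsupp.linearCombination ℤ (fun ρ => if ρ ∈ rowBox i j X ρ₀ then (1 : ℤ) else 0) y = 0) ∧
    ∀ ρ, y ρ ≠ 0 → ∃ g : Equiv.Perm (Fin n), ρ = r ∘ g}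
  zero_mem' := by simp
  add_mem' := by
    rintro a b ⟨ha, ha'⟩ ⟨hb, hb'⟩
    refine ⟨fun i j X ρ₀ hij h => ?_, fun ρ h => ?_⟩
    · rw [map_add, ha i j X ρ₀ hij h, hb i j X ρ₀ hij h, add_zero]
    · by_cases h1 : a ρ = 0
      · exact hb' ρ (by simpa [h1] using h)
      · exact ha' ρ h1
  smul_mem' := by
    rintro z a ⟨ha, ha'⟩
    refine ⟨fun i j X ρ₀ hij h => ?_, fun ρ h => ?_⟩
    · rw [map_smul, ha i j X ρ₀ hij h, smul_zero]
    · exact ha' ρ (fun h1 => h (by simp [h1]))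

/-- A weight on row functions that is strictly monotone for dominance. -/
noncomputable def domWeight {n : ℕ} (k : ℕ) (ρ : Fin n → ℕ) : ℕ :=
  ∑ i ∈ Finset.range (n + 1), ∑ R ∈ Finset.range (k + 1), shCount ρ i R

lemma domWeight_eq {n k : ℕ} (ρ : Fin n → ℕ) (hρ : ∀ m, ρ m < k) :
    (domWeight k ρ : ℤ) = ∑ m : Fin n, ((n : ℤ) - (m : ℕ)) * ((k : ℤ) - ρ m) := by
  have key : ∀ a N : ℕ, a ≤ N →
      ∑ i ∈ Finset.range (N + 1), (if a < i then (1 : ℤ) else 0) = (N : ℤ) - a := by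
    intro a N h
    induction N, h using Nat.le_induction with
    | base =>
      rw [sub_self]
      refine Finset.sum_eq_zero fun i hi => if_neg ?_
      have := Finset.mem_range.1 hi
      omega
    | succ N h ih =>
      rw [Finset.sum_range_succ, ih, if_pos (by omega)]
      push_cast
      ring
  have h1 : (domWeight k ρ : ℤ) = ∑ i ∈ Finset.range (n + 1), ∑ R ∈ Finset.range (k + 1),
      ∑ m : Fin n, (if (m : ℕ) < i then (1 : ℤ) else 0) * (if ρ m < R then 1 else 0) := by
    unfold domWeight shCount
    push_cast [Finset.card_filter]
    refine Finset.sum_congr rfl fun i _ => Finset.sum_congr rfl fun R _ =>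
      Finset.sum_congr rfl fun m _ => ?_
    by_cases h : (m : ℕ) < i <;> by_cases h' : ρ m < R <;> simp [h, h']
  rw [h1, Finset.sum_congr rfl fun i _ => Finset.sum_comm, Finset.sum_comm]
  refine Finset.sum_congr rfl fun m _ => ?_
  rw [← key m n m.2.le, ← key (ρ m) k (hρ m).le, Finset.sum_mul_sum]

lemma shCount_succ {n : ℕ} (ρ : Fin n → ℕ) (m : Fin n) (R : ℕ) :
    shCount ρ (m + 1) R = shCount ρ m R + if ρ m < R then 1 else 0 := by
  unfold shCount
  split_ifs with h
  · rw [← Finset.card_insert_of_notMem (a := m) (by simp)]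
    congr 1
    ext x
    simp only [Finset.mem_filter, Finset.mem_univ, true_and, Finset.mem_insert, Fin.ext_iff]
    constructor
    · rintro ⟨h1, h2⟩
      by_cases hx : (x : ℕ) = m
      · exact Or.inl hx
      · exact Or.inr ⟨by omega, h2⟩
    · rintro (h1 | ⟨h1, h2⟩)
      · obtain rfl := Fin.ext h1
        exact ⟨by omega, h⟩
      · exact ⟨by omega, h2⟩
  · rw [add_zero]
    congr 1
    ext x
    simp only [Finset.mem_filter, Finset.mem_univ, true_and]
    refine and_congr_left fun h2 => ⟨fun h1 => ?_, fun h1 => by omega⟩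
    by_contra h3
    have : x = m := Fin.ext (by omega)
    exact h (this ▸ h2)

lemma domWeight_lt {n k : ℕ} {ρ ρ' : Fin n → ℕ} (hρ : ∀ m, ρ m < k) (hρ' : ∀ m, ρ' m < k)
    (hd : TabDominates ρ ρ') (hne : ρ ≠ ρ') : domWeight k ρ' < domWeight k ρ := by
  by_contra hlt
  have hle : ∀ i ∈ Finset.range (n + 1), ∑ R ∈ Finset.range (k + 1), shCount ρ' i R ≤
      ∑ R ∈ Finset.range (k + 1), shCount ρ i R :=
    fun i _ => Finset.sum_le_sum fun R _ => hd i R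
  have heq := (Finset.sum_eq_sum_iff_of_le hle).1
    (le_antisymm (Finset.sum_le_sum hle) (not_lt.1 hlt))
  have hsh : ∀ i ≤ n, ∀ R ≤ k, shCount ρ' i R = shCount ρ i R := fun i hi R hR =>
    (Finset.sum_eq_sum_iff_of_le fun R _ => hd i R).1 (heq i (Finset.mem_range.2 (by omega))) R
      (Finset.mem_range.2 (by omega))
  apply hne
  funext m
  have h1 : ∀ R ≤ k, (ρ m < R ↔ ρ' m < R) := by
    intro R hR
    have e1 := hsh (m + 1) m.2 R hR
    rw [shCount_succ, shCount_succ, hsh m m.2.le R hR] at e1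
    by_cases h : ρ m < R <;> by_cases h' : ρ' m < R <;> simp [h, h'] at e1 ⊢
  have h2 := h1 (ρ m + 1) (hρ m)
  have h3 := h1 (ρ' m + 1) (hρ' m)
  omega

lemma polytabloid_apply {n : ℕ} (r c ρ : Fin n → ℕ) :
    polytabloid r c ρ = ∑ g ∈ Finset.univ.filter (fun g : Equiv.Perm (Fin n) => c ∘ ⇑g = c),
      if r ∘ ⇑g⁻¹ = ρ then (Equiv.Perm.sign g : ℤ) else 0 := by
  unfold polytabloid
  rw [Finsupp.finsetSum_apply]
  refine Finset.sum_congr rfl fun g _ => ?_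
  rw [Finsupp.smul_apply, Finsupp.single_apply]
  split_ifs <;> simp

lemma exists_perm_of_polytabloid_apply_ne_zero {n : ℕ} {r c ρ : Fin n → ℕ}
    (h : polytabloid r c ρ ≠ 0) :
    ∃ g : Equiv.Perm (Fin n), c ∘ ⇑g = c ∧ r ∘ ⇑g⁻¹ = ρ := by
  rw [polytabloid_apply] at h
  obtain ⟨g, hg, hg'⟩ := Finset.exists_ne_zero_of_sum_ne_zero h
  exact ⟨g, (Finset.mem_filter.1 hg).2, by_contra fun h' => hg' (if_neg h')⟩

lemma comp_inv_eq {n : ℕ} {c : Fin n → ℕ} {g : Equiv.Perm (Fin n)} (hg : c ∘ ⇑g = c) (x : Fin n) :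
    c (g⁻¹ x) = c x := by
  have := congrFun hg (g⁻¹ x)
  simpa using this.symm

lemma polytabloid_apply_self {n : ℕ} {r c : Fin n → ℕ}
    (hinj : Function.Injective (fun m : Fin n => (r m, c m))) : polytabloid r c r = 1 := by
  rw [polytabloid_apply, Finset.sum_eq_single 1]
  · simp
  · intro g hg hne
    refine if_neg fun h => hne ?_
    have hc := comp_inv_eq (Finset.mem_filter.1 hg).2
    have : g⁻¹ = 1 := Equiv.ext fun x => hinj (Prod.ext (congrFun h x) (hc x))
    simpa using this
  · intro h
    exact absurd (Finset.mem_filter.2 ⟨Finset.mem_univ _, by simp⟩) h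

lemma tabDominates_comp_inv {n : ℕ} {r c : Fin n → ℕ} (hcol : ColStd r c)
    {g : Equiv.Perm (Fin n)} (hg : c ∘ ⇑g = c) : TabDominates r (r ∘ ⇑g⁻¹) := by
  intro i R
  unfold shCount
  rw [Finset.card_eq_sum_card_image c, Finset.card_eq_sum_card_fiberwise
    (f := c) (t := Finset.univ.image c) (s := Finset.univ.filter _)
    (fun x _ => by simp)]
  refine (Finset.sum_le_sum_of_subset (Finset.image_subset_image (Finset.filter_subset _ _))).trans
    (Finset.sum_le_sum fun j _ => ?_)
  simp only [Finset.filter_filter]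
  by_cases H : ∀ m, c m = j → (m : ℕ) < i → r m < R
  · refine Finset.card_le_card fun m hm => ?_
    simp only [Finset.mem_filter, Finset.mem_univ, true_and] at hm ⊢
    exact ⟨⟨hm.1.1, H m hm.2 hm.1.1⟩, hm.2⟩
  · push Not at H
    obtain ⟨m₀, hm₀, hi, hR⟩ := H
    refine Finset.card_le_card_of_injOn (g⁻¹ : Equiv.Perm (Fin n)) (fun m hm => ?_)
      (Equiv.injective _).injOn
    simp only [Finset.coe_filter, Finset.mem_univ, true_and, Set.mem_ofPred_eq,
      Function.comp_apply] at hm ⊢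
    have hc := comp_inv_eq hg m
    refine ⟨⟨?_, hm.1.2⟩, hc.trans hm.2⟩
    have : g⁻¹ m < m₀ := hcol _ _ (hc.trans (hm.2.trans hm₀.symm)) (lt_of_lt_of_le hm.1.2 hR)
    exact lt_trans this hi

lemma polytabloid_mem_boxKernel {n k : ℕ} {lam : ℕ → ℕ}
    (hanti : ∀ i j, i ≤ j → lam j ≤ lam i) {s r c : Fin n → ℕ} (htab : IsTabOf lam k r c)
    (hs : ∃ g : Equiv.Perm (Fin n), r = s ∘ g) :
    polytabloid r c ∈ boxKernel lam s := by
  refine ⟨fun i j X ρ₀ hij hX => ?_, fun ρ hρ => ?_⟩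
  · unfold polytabloid
    rw [map_sum]
    simp only [map_smul, Finsupp.linearCombination_single, one_smul]
    by_cases hinj : Set.InjOn c X
    · obtain ⟨x, hx, hcx⟩ : ∃ x ∈ X, lam i ≤ c x := by
        by_contra! h
        have := Finset.card_le_card_of_injOn (t := Finset.range (lam i)) c
          (fun x hx => by simpa using h x hx) hinj
        rw [Finset.card_range] at this
        omega
      refine Finset.sum_eq_zero fun g hg => ?_
      rw [if_neg, smul_zero]
      rintro ⟨-, h⟩
      have hc := comp_inv_eq (Finset.mem_filter.1 hg).2 x
      have h1 := (htab.1 (g⁻¹ x)).2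
      have h2 : lam (r (g⁻¹ x)) ≤ lam i := by
        rcases h x hx with h | h
        · exact hanti _ _ (le_of_eq h.symm)
        · exact hanti _ _ (hij.trans (le_of_eq h.symm))
      omega
    · obtain ⟨x, hx, x', hx', hc, hne⟩ : ∃ x ∈ X, ∃ x' ∈ X, c x = c x' ∧ x ≠ x' := by
        unfold Set.InjOn at hinj
        push Not at hinj
        obtain ⟨x, hx, x', hx', h⟩ := hinj
        exact ⟨x, hx, x', hx', h⟩
      have hswap : ∀ g : Equiv.Perm (Fin n), r ∘ ⇑g⁻¹ ∈ rowBox i j X ρ₀ →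
          r ∘ ⇑(Equiv.swap x x' * g)⁻¹ ∈ rowBox i j X ρ₀ := by
        rintro g ⟨h1, h2⟩
        simp only [mul_inv_rev, Equiv.swap_inv, Equiv.Perm.coe_mul]
        refine ⟨fun m hm => ?_, fun m hm => ?_⟩
        · have e : Equiv.swap x x' m = m := Equiv.swap_apply_of_ne_of_ne
            (fun h => hm (h ▸ hx)) (fun h => hm (h ▸ hx'))
          simpa [e] using h1 m hm
        · refine h2 (Equiv.swap x x' m) ?_
          rw [Equiv.swap_apply_def]
          split_ifs <;> assumption
      refine Finset.sum_involution (fun g _ => Equiv.swap x x' * g) (fun g hg => ?_)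
        (fun g hg _ h => ?_) (fun g hg => ?_) (fun g hg => ?_)
      · have hiff : r ∘ ⇑(Equiv.swap x x' * g)⁻¹ ∈ rowBox i j X ρ₀ ↔
            r ∘ ⇑g⁻¹ ∈ rowBox i j X ρ₀ :=
          ⟨fun h => by simpa [← mul_assoc] using hswap _ h, hswap g⟩
        simp only [hiff, Equiv.Perm.sign_mul, Equiv.Perm.sign_swap hne]
        split_ifs <;> simp
      · exact hne (by simpa using h)
      · rw [Finset.mem_filter] at hg ⊢
        refine ⟨Finset.mem_univ _, funext fun m => ?_⟩
        have hcg := congrFun hg.2 m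
        simp only [Function.comp_apply, Equiv.Perm.coe_mul] at hcg ⊢
        rw [← hcg, Equiv.swap_apply_def]
        split_ifs with h h' <;> simp [*]
      · simp [← mul_assoc]
  · obtain ⟨g, -, rfl⟩ := exists_perm_of_polytabloid_apply_ne_zero hρ
    obtain ⟨g', rfl⟩ := hs
    exact ⟨g' * g⁻¹, by simp [Function.comp_assoc]⟩

lemma card_row_eq {n k : ℕ} {lam : ℕ → ℕ} (hsum : ∑ i ∈ Finset.range k, lam i = n)
    {r c : Fin n → ℕ} (htab : IsTabOf lam k r c) {i : ℕ} (hi : i < k) :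
    (Finset.univ.filter (fun m => r m = i)).card = lam i := by
  have hle : ∀ i ∈ Finset.range k, (Finset.univ.filter (fun m => r m = i)).card ≤ lam i := by
    intro i _
    rw [← Finset.card_range (lam i)]
    refine Finset.card_le_card_of_injOn c (fun m hm => ?_) (fun m hm m' hm' h => ?_)
    · have := (htab.1 m).2
      simp only [Finset.coe_filter, Finset.mem_univ, true_and, Set.mem_ofPred_eq] at hm
      simpa [← hm] using this
    · simp only [Finset.coe_filter, Finset.mem_univ, true_and, Set.mem_ofPred_eq] at hm hm'
      exact htab.2 (Prod.ext (hm.trans hm'.symm) h)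
  refine (Finset.sum_eq_sum_iff_of_le hle).1 ?_ i (Finset.mem_range.2 hi)
  rw [hsum, ← Finset.card_eq_sum_card_fiberwise (f := r) (s := Finset.univ)
    (fun m _ => by simpa using (htab.1 m).1)]
  simp

lemma card_row_comp_perm {n : ℕ} (r : Fin n → ℕ) (g : Equiv.Perm (Fin n)) (i : ℕ) :
    (Finset.univ.filter (fun m => (r ∘ g) m = i)).card =
      (Finset.univ.filter (fun m => r m = i)).card :=
  Finset.card_equiv g (by simp)

lemma rowStd_rowSortCol {n : ℕ} (r : Fin n → ℕ) : RowStd r (rowSortCol r) := by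
  intro m m' hr hc
  by_contra h
  refine absurd hc (not_lt.2 (Finset.card_le_card fun x hx => ?_))
  simp only [Finset.mem_filter, Finset.mem_univ, true_and] at hx ⊢
  exact ⟨hx.1.trans hr.symm, hx.2.trans_le (not_lt.1 h)⟩

lemma rowSortCol_lt {n : ℕ} (r : Fin n → ℕ) {m m' : Fin n} (hr : r m = r m') (h : m < m') :
    rowSortCol r m < rowSortCol r m' := by
  refine Finset.card_lt_card (Finset.ssubset_iff_subset_ne.2 ⟨fun x hx => ?_, fun he => ?_⟩)
  · simp only [Finset.mem_filter, Finset.mem_univ, true_and] at hx ⊢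
    exact ⟨hx.1.trans hr, hx.2.trans h⟩
  · have : m ∈ Finset.univ.filter (fun m' : Fin n => r m' = r m ∧ m' < m) := by
      rw [he]; simp [hr, h]
    simp at this

lemma isTabOf_rowSortCol {n k : ℕ} {lam : ℕ → ℕ} {r : Fin n → ℕ} (hk : ∀ m, r m < k)
    (hrow : ∀ i < k, (Finset.univ.filter (fun m => r m = i)).card = lam i) :
    IsTabOf lam k r (rowSortCol r) := by
  refine ⟨fun m => ⟨hk m, ?_⟩, fun m m' h => ?_⟩
  · rw [← hrow _ (hk m)]
    refine Finset.card_lt_card (Finset.ssubset_iff_subset_ne.2 ⟨fun x hx => ?_, fun he => ?_⟩)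
    · simp only [Finset.mem_filter, Finset.mem_univ, true_and] at hx ⊢
      exact hx.1
    · have : m ∈ Finset.univ.filter (fun m' : Fin n => r m' = r m ∧ m' < m) := by
        rw [he]; simp
      simp at this
  · obtain ⟨h1, h2⟩ := Prod.ext_iff.1 h
    dsimp only at h1 h2
    rcases lt_trichotomy m m' with hlt | rfl | hlt
    · exact absurd h2 (rowSortCol_lt r h1 hlt).ne
    · rfl
    · exact absurd h2 (rowSortCol_lt r h1.symm hlt).ne'

/-- A tabloid of maximal weight in an element of `boxKernel` is standard. -/
lemma colStd_of_maximal {n k : ℕ} {lam : ℕ → ℕ} {r ρ : Fin n → ℕ}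
    {y : (Fin n → ℕ) →₀ ℤ} (hy : y ∈ boxKernel lam r) (hk : ∀ m, r m < k)
    (hrow : ∀ i < k, (Finset.univ.filter (fun m => r m = i)).card = lam i)
    (hρ : y ρ ≠ 0) (hmax : ∀ ρ', y ρ' ≠ 0 → domWeight k ρ' ≤ domWeight k ρ) :
    ColStd ρ (rowSortCol ρ) := by
  intro a b hab hr
  by_contra hlt
  have hba : b < a := lt_of_le_of_ne (not_lt.1 hlt) (fun h => by simp [h] at hr)
  obtain ⟨g, hg⟩ := hy.2 ρ hρ
  have hρk : ∀ m, ρ m < k := fun m => by rw [hg]; exact hk _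
  have hcard := card_row_comp_perm r g (ρ a)
  rw [← hg, hrow _ (hρk a)] at hcard
  set A := Finset.univ.filter (fun m => ρ m = ρ a ∧ a ≤ m) with hA
  set B := Finset.univ.filter (fun m => ρ m = ρ b ∧ m ≤ b) with hB
  have cA : rowSortCol ρ a + A.card = lam (ρ a) := by
    rw [← hcard, ← Finset.card_filter_add_card_filter_not
      (s := Finset.univ.filter fun m => ρ m = ρ a) (fun m => m < a)]
    simp only [Finset.filter_filter, not_lt]
    rfl
  have cB : B.card = rowSortCol ρ b + 1 := by
    unfold rowSortCol
    rw [← Finset.card_insert_of_notMem (a := b) (by simp)]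
    congr 1
    ext x
    simp only [hB, Finset.mem_filter, Finset.mem_univ, true_and, Finset.mem_insert]
    constructor
    · rintro ⟨h1, h2⟩
      exact h2.eq_or_lt.imp id fun h => ⟨h1, h⟩
    · rintro (rfl | ⟨h1, h2⟩)
      · simp
      · exact ⟨h1, h2.le⟩
  have hdisj : Disjoint A B := by
    rw [Finset.disjoint_left]
    intro x hx hx'
    simp only [hA, hB, Finset.mem_filter, Finset.mem_univ, true_and] at hx hx'
    exact absurd (hx.2.trans hx'.2) (not_le.2 hba)
  have hX : lam (ρ a) < (A ∪ B).card := by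
    rw [Finset.card_union_of_disjoint hdisj]; omega
  have h0 := hy.1 (ρ a) (ρ b) (A ∪ B) ρ hr.le hX
  rw [Finsupp.linearCombination_apply, Finsupp.sum, Finset.sum_eq_single ρ] at h0
  · rw [if_pos] at h0
    · exact hρ (by simpa using h0)
    · refine ⟨fun _ _ => rfl, fun m hm => ?_⟩
      simp only [hA, hB, Finset.mem_union, Finset.mem_filter, Finset.mem_univ, true_and] at hm
      exact hm.imp And.left And.left
  · intro ρ' hρ' hne
    rw [if_neg, smul_zero]
    rintro ⟨hoff, hon⟩
    have hρ'0 := Finsupp.mem_support_iff.1 hρ'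
    obtain ⟨g', hg'⟩ := hy.2 ρ' hρ'0
    have hρ'k : ∀ m, ρ' m < k := fun m => by rw [hg']; exact hk _
    have hsum : ∑ m, (ρ' m : ℤ) = ∑ m, (ρ m : ℤ) := by
      rw [hg, hg']
      exact (Equiv.sum_comp g' (fun m => (r m : ℤ))).trans
        (Equiv.sum_comp g (fun m => (r m : ℤ))).symm
    have hle : (domWeight k ρ' : ℤ) ≤ domWeight k ρ := by exact_mod_cast hmax ρ' hρ'0
    rw [domWeight_eq _ hρk, domWeight_eq _ hρ'k] at hle
    have hterm : ∀ m, ρ' m = ρ m ∨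
        0 < (2 * ((m : ℕ) : ℤ) - 2 * ((b : ℕ) : ℤ) - 1) * ((ρ' m : ℤ) - ρ m) := by
      intro m
      by_cases hm : m ∈ A ∪ B
      · have h1 := hon m hm
        simp only [hA, hB, Finset.mem_union, Finset.mem_filter, Finset.mem_univ, true_and] at hm
        rcases hm with ⟨h2, h3⟩ | ⟨h2, h3⟩
        · rcases h1 with h1 | h1
          · exact Or.inl (h1.trans h2.symm)
          · right
            have : b < m := hba.trans_le h3
            rw [Fin.lt_def] at this
            exact mul_pos (by omega) (by omega)
        · rcases h1 with h1 | h1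
          · right
            rw [Fin.le_def] at h3
            exact mul_pos_of_neg_of_neg (by omega) (by omega)
          · exact Or.inl (h1.trans h2.symm)
      · exact Or.inl (hoff m hm)
    obtain ⟨x, hx⟩ := Function.ne_iff.1 hne
    have hpos : 0 < ∑ m : Fin n,
        (2 * ((m : ℕ) : ℤ) - 2 * ((b : ℕ) : ℤ) - 1) * ((ρ' m : ℤ) - ρ m) := by
      refine Finset.sum_pos' (fun m _ => ?_) ⟨x, Finset.mem_univ _, (hterm x).resolve_left hx⟩
      rcases hterm m with h | h
      · simp [h]
      · exact h.le
    have hid : ∑ m : Fin n,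
        (2 * ((m : ℕ) : ℤ) - 2 * ((b : ℕ) : ℤ) - 1) * ((ρ' m : ℤ) - ρ m) =
        2 * (∑ m : Fin n, ((n : ℤ) - (m : ℕ)) * ((k : ℤ) - ρ' m) -
          ∑ m : Fin n, ((n : ℤ) - (m : ℕ)) * ((k : ℤ) - ρ m)) +
        (2 * (n : ℤ) - 2 * ((b : ℕ) : ℤ) - 1) * (∑ m, (ρ' m : ℤ) - ∑ m, (ρ m : ℤ)) := by
      simp only [← Finset.sum_sub_distrib, Finset.mul_sum, ← Finset.sum_add_distrib]
      exact Finset.sum_congr rfl fun m _ => by ring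
    rw [hid, hsum] at hpos
    linarith
  · intro h
    exact absurd (Finsupp.mem_support_iff.2 hρ) h

lemma TabDominates.trans {n : ℕ} {a b c : Fin n → ℕ} (h : TabDominates a b)
    (h' : TabDominates b c) : TabDominates a c :=
  fun i R => (h' i R).trans (h i R)

lemma polytabloid_apply_ne_zero_imp {n k : ℕ} {r c ρ : Fin n → ℕ} (hk : ∀ m, r m < k)
    (hcol : ColStd r c) (h : polytabloid r c ρ ≠ 0) :
    TabDominates r ρ ∧ (r ≠ ρ → domWeight k ρ < domWeight k r) := by
  obtain ⟨g, hg, rfl⟩ := exists_perm_of_polytabloid_apply_ne_zero h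
  have hd := tabDominates_comp_inv hcol hg
  exact ⟨hd, domWeight_lt hk (fun _ => hk _) hd⟩

/-- An element of `boxKernel` supported strictly below `r` is an integral combination of standard
polytabloids strictly below `r`. -/
lemma mem_span_of_mem_boxKernel {n k : ℕ} {lam : ℕ → ℕ}
    (hanti : ∀ i j, i ≤ j → lam j ≤ lam i) {r : Fin n → ℕ} (hk : ∀ m, r m < k)
    (hrow : ∀ i < k, (Finset.univ.filter (fun m => r m = i)).card = lam i)
    (W : ℕ) (hW : W ≤ domWeight k r) (y : (Fin n → ℕ) →₀ ℤ) (hy : y ∈ boxKernel lam r)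
    (hsupp : ∀ ρ, y ρ ≠ 0 → TabDominates r ρ ∧ domWeight k ρ < W) :
    y ∈ Submodule.span ℤ
        {x : (Fin n → ℕ) →₀ ℤ | ∃ rv cv : Fin n → ℕ,
          IsTabOf lam k rv cv ∧ RowStd rv cv ∧ ColStd rv cv ∧
          TabDominates r rv ∧ r ≠ rv ∧ x = polytabloid rv cv} := by
  induction W generalizing y with
  | zero =>
    have : y = 0 := Finsupp.ext fun ρ => by
      by_contra h
      exact absurd (hsupp ρ h).2 (Nat.not_lt_zero _)
    rw [this]
    exact Submodule.zero_mem _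
  | succ W ih =>
    set T := y.support.filter (fun ρ => domWeight k ρ = W) with hT
    have hTmem : ∀ ρ ∈ T, y ρ ≠ 0 ∧ domWeight k ρ = W := fun ρ h => by
      simpa [hT] using h
    have hstd : ∀ ρ ∈ T, (∃ g : Equiv.Perm (Fin n), ρ = r ∘ g) ∧ (∀ m, ρ m < k) ∧
        IsTabOf lam k ρ (rowSortCol ρ) ∧ ColStd ρ (rowSortCol ρ) := by
      intro ρ hρ
      obtain ⟨h0, hw⟩ := hTmem ρ hρ
      obtain ⟨g, hg⟩ := hy.2 ρ h0
      have hρk : ∀ m, ρ m < k := fun m => by rw [hg]; exact hk _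
      refine ⟨⟨g, hg⟩, hρk, isTabOf_rowSortCol hρk fun i hi => ?_,
        colStd_of_maximal hy hk hrow h0 fun ρ' h' => ?_⟩
      · rw [hg, card_row_comp_perm, hrow i hi]
      · have := (hsupp ρ' h').2
        omega
    have hspan : ∑ ρ ∈ T, y ρ • polytabloid ρ (rowSortCol ρ) ∈ Submodule.span ℤ
        {x : (Fin n → ℕ) →₀ ℤ | ∃ rv cv : Fin n → ℕ,
          IsTabOf lam k rv cv ∧ RowStd rv cv ∧ ColStd rv cv ∧
          TabDominates r rv ∧ r ≠ rv ∧ x = polytabloid rv cv} := by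
      refine Submodule.sum_mem _ fun ρ hρ => Submodule.smul_mem _ _ (Submodule.subset_span ?_)
      obtain ⟨-, -, htab, hcol⟩ := hstd ρ hρ
      obtain ⟨h0, hw⟩ := hTmem ρ hρ
      refine ⟨ρ, rowSortCol ρ, htab, rowStd_rowSortCol ρ, hcol, (hsupp ρ h0).1, ?_, rfl⟩
      rintro rfl
      omega
    rw [← sub_add_cancel y (∑ ρ ∈ T, y ρ • polytabloid ρ (rowSortCol ρ))]
    refine Submodule.add_mem _ (ih (by omega) _ ?_ fun ρ hρ => ?_) hspan
    · refine Submodule.sub_mem _ hy (Submodule.sum_mem _ fun ρ hρ => Submodule.smul_mem _ _ ?_)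
      obtain ⟨hg, -, htab, -⟩ := hstd ρ hρ
      exact polytabloid_mem_boxKernel hanti htab hg
    · have hoff : ∀ ρ' ∈ T, ρ' ≠ ρ → polytabloid ρ' (rowSortCol ρ') ρ ≠ 0 →
          TabDominates r ρ ∧ domWeight k ρ < W := by
        intro ρ' hρ' hne h
        obtain ⟨-, hk', -, hcol⟩ := hstd ρ' hρ'
        obtain ⟨h0, hw⟩ := hTmem ρ' hρ'
        obtain ⟨h1, h2⟩ := polytabloid_apply_ne_zero_imp hk' hcol h
        exact ⟨(hsupp ρ' h0).1.trans h1, hw ▸ h2 hne⟩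
      by_contra hcon
      have hzero : ∀ ρ' ∈ T, ρ' ≠ ρ → polytabloid ρ' (rowSortCol ρ') ρ = 0 :=
        fun ρ' hρ' hne => by_contra fun h => hcon (hoff ρ' hρ' hne h)
      apply hρ
      rw [Finsupp.sub_apply, Finsupp.finsetSum_apply]
      by_cases hρT : ρ ∈ T
      · rw [Finset.sum_eq_single_of_mem ρ hρT fun ρ' h' hne => by
            rw [Finsupp.smul_apply, hzero ρ' h' hne, smul_zero],
          Finsupp.smul_apply, polytabloid_apply_self (hstd ρ hρT).2.2.1.2]
        simp
      · rw [Finset.sum_eq_zero fun ρ' h' => by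
            rw [Finsupp.smul_apply, hzero ρ' h' fun h => hρT (h ▸ h'), smul_zero], sub_zero]
        by_contra h0
        obtain ⟨h1, h2⟩ := hsupp ρ h0
        refine hcon ⟨h1, lt_of_le_of_ne (Nat.lt_succ_iff.1 h2) fun h => hρT ?_⟩
        simp [hT, h0, h]

/-- Let `u` be a column-standard `λ`-tableau.  Then, over `ℤ`,
`e_u = e_ū + x`, where `ū` is the row-straightening of `u` (same row
function; the entry `m` moves to column `#{m' in the same row : m' < m}`)
and `x` is an integral linear combination of standard polytabloids `e_v`
with `ū` strictly dominating `v`. -/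
theorem stmt_13 (n k : ℕ) (lam : ℕ → ℕ)
    (hanti : ∀ i j, i ≤ j → lam j ≤ lam i)
    (hsum : ∑ i ∈ Finset.range k, lam i = n)
    (r c : Fin n → ℕ)
    (htab : IsTabOf lam k r c)
    (hcol : ColStd r c) :
    -- the row-straightening ū of u has the same rows, sorted increasingly:
    let cbar : Fin n → ℕ := fun m =>
      (Finset.univ.filter (fun m' : Fin n => r m' = r m ∧ m' < m)).card
    polytabloid r c - polytabloid r cbar ∈
      Submodule.span ℤ
        {x : (Fin n → ℕ) →₀ ℤ | ∃ rv cv : Fin n → ℕ,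
          IsTabOf lam k rv cv ∧ RowStd rv cv ∧ ColStd rv cv ∧
          TabDominates r rv ∧ r ≠ rv ∧ x = polytabloid rv cv} := by
  intro cbar
  have hk : ∀ m, r m < k := fun m => (htab.1 m).1
  have hrow : ∀ i < k, (Finset.univ.filter (fun m => r m = i)).card = lam i :=
    fun i hi => card_row_eq hsum htab hi
  have hself : ∃ g : Equiv.Perm (Fin n), r = r ∘ g := ⟨1, by simp⟩
  have hu := polytabloid_mem_boxKernel hanti htab hself
  have htab' : IsTabOf lam k r cbar := isTabOf_rowSortCol hk hrow
  have hcol' : ColStd r cbar := by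
    refine colStd_of_maximal hu hk hrow (by simp [polytabloid_apply_self htab.2]) fun ρ h => ?_
    by_cases hne : r = ρ
    · rw [hne]
    · exact ((polytabloid_apply_ne_zero_imp hk hcol h).2 hne).le
  refine mem_span_of_mem_boxKernel hanti hk hrow _ le_rfl _
    (Submodule.sub_mem _ hu (polytabloid_mem_boxKernel hanti htab' hself)) fun ρ hρ => ?_
  rw [Finsupp.sub_apply] at hρ
  have hne : r ≠ ρ := by
    rintro rfl
    simp [polytabloid_apply_self htab.2, polytabloid_apply_self htab'.2] at hρ
  by_cases h : polytabloid r c ρ = 0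
  · have h' : polytabloid r cbar ρ ≠ 0 := fun h' => hρ (by rw [h, h', sub_zero])
    exact (polytabloid_apply_ne_zero_imp hk hcol' h').imp_right fun f => f hne
  · exact (polytabloid_apply_ne_zero_imp hk hcol h).imp_right fun f => f hne
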